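/- Optimality example for the degenerate equation: Let 0 < γ < 1 and ε ∈ (0,γ]. Define u(x,t) = 1 − x_n^{2−ε}/((2−ε)(1−ε)) on the half-space {x ∈ ℝ^n : x_n > 0} × ℝ. Then u is a classical (hence viscosity) solution of u_t − x_n^γ Δu = x_n^{γ−ε} in {x_n > 0} × ℝ, and its spatial gradient satisfies |Du(x,t)| = x_n^{1−ε}/(1−ε); in particular, for ε = γ the function u is exactly C^{1,1−γ} up to the flat boundary {x_n = 0} and no better. -/

import Mathlib

noncomputable section

open Real Topology Filter Set MeasureTheory

namespace DPP

/-- Space-time points. -/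
abbrev Pt (n : ℕ) := (Fin n → ℝ) × ℝ

/-- The last index of `Fin n`. -/
def lastIdx (n : ℕ) [NeZero n] : Fin n :=
  ⟨n - 1, Nat.sub_lt (Nat.pos_of_ne_zero (NeZero.ne n)) one_pos⟩

/-- The last spatial coordinate `x_n`. -/
def xlast {n : ℕ} [NeZero n] (x : Fin n → ℝ) : ℝ := x (lastIdx n)

/-- Euclidean norm on `Fin n → ℝ`. -/
def eucNorm {n : ℕ} (x : Fin n → ℝ) : ℝ := Real.sqrt (∑ i, (x i) ^ 2)

/-- Euclidean norm of the first `n-1` coordinates (the `x'` part). -/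
def eucNormPrime {n : ℕ} [NeZero n] (x : Fin n → ℝ) : ℝ :=
  Real.sqrt (∑ i, if i = lastIdx n then 0 else (x i) ^ 2)

/-- Frobenius norm of a matrix. -/
def matNorm {n : ℕ} (M : Matrix (Fin n) (Fin n) ℝ) : ℝ :=
  Real.sqrt (∑ i, ∑ j, (M i j) ^ 2)

/-- The intrinsic parabolic quasidistance `|x-y| + |t-s|^(1/(2-γ))`. -/
def pdist {n : ℕ} (γ : ℝ) (p q : Pt n) : ℝ :=
  eucNorm (p.1 - q.1) + |p.2 - q.2| ^ ((1 : ℝ) / (2 - γ))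

/-- The intrinsic cylinder `Q_r(x₀,t₀)`. -/
def Qcyl {n : ℕ} (γ r : ℝ) (x₀ : Fin n → ℝ) (t₀ : ℝ) : Set (Pt n) :=
  {p | eucNorm (p.1 - x₀) < r ∧ t₀ - r ^ (2 - γ) < p.2 ∧ p.2 ≤ t₀}

/-- The upper intrinsic cylinder `Q_r⁺(x₀,t₀)`. -/
def Qp {n : ℕ} [NeZero n] (γ r : ℝ) (x₀ : Fin n → ℝ) (t₀ : ℝ) : Set (Pt n) :=
  {p ∈ Qcyl γ r x₀ t₀ | 0 < xlast p.1}

/-- `Q₁⁺`. -/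
def Q1p (n : ℕ) [NeZero n] (γ : ℝ) : Set (Pt n) := Qp γ 1 (0 : Fin n → ℝ) 0

/-- The parabolic boundary of `Q₁⁺`. -/
def pbQ1p (n : ℕ) [NeZero n] (γ : ℝ) : Set (Pt n) := closure (Q1p n γ) \ Q1p n γ

/-- The flat part `∂_p Q₁⁺ ∩ {x_n = 0}`. -/
def flatQ1p (n : ℕ) [NeZero n] (γ : ℝ) : Set (Pt n) :=
  {p ∈ pbQ1p n γ | xlast p.1 = 0}

/-- Symmetric matrices `A` with `λ I ≤ A ≤ Λ I`. -/
def ellipticMats (n : ℕ) (lam Lam : ℝ) : Set (Matrix (Fin n) (Fin n) ℝ) :=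
  {A | A.IsSymm ∧ ∀ v : Fin n → ℝ,
    lam * ∑ i, (v i) ^ 2 ≤ ∑ i, ∑ j, A i j * v i * v j ∧
    ∑ i, ∑ j, A i j * v i * v j ≤ Lam * ∑ i, (v i) ^ 2}

/-- Pucci maximal operator `𝓜⁺`. -/
def pucciPlus {n : ℕ} (lam Lam : ℝ) (M : Matrix (Fin n) (Fin n) ℝ) : ℝ :=
  sSup ((fun A => (A * M).trace) '' ellipticMats n lam Lam)

/-- Pucci minimal operator `𝓜⁻`. -/
def pucciMinus {n : ℕ} (lam Lam : ℝ) (M : Matrix (Fin n) (Fin n) ℝ) : ℝ :=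
  sInf ((fun A => (A * M).trace) '' ellipticMats n lam Lam)

/-- A test function: continuous, `C¹` in time and `C²` in space. -/
def IsTestFn {n : ℕ} (φ : Pt n → ℝ) : Prop :=
  Continuous φ ∧ (∀ x : Fin n → ℝ, ContDiff ℝ 1 fun t => φ (x, t)) ∧
    ∀ t : ℝ, ContDiff ℝ 2 fun x => φ (x, t)

/-- The time derivative of `φ` at `p`. -/
def timeD {n : ℕ} (φ : Pt n → ℝ) (p : Pt n) : ℝ := deriv (fun s => φ (p.1, s)) p.2

/-- The spatial gradient of `φ` at `p`. -/
def spaceGrad {n : ℕ} (φ : Pt n → ℝ) (p : Pt n) : Fin n → ℝ :=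
  fun i => fderiv ℝ (fun x => φ (x, p.2)) p.1 (Pi.single i 1)

/-- The spatial Hessian of `φ` at `p`. -/
def hess {n : ℕ} (φ : Pt n → ℝ) (p : Pt n) : Matrix (Fin n) (Fin n) ℝ :=
  fun i j =>
    fderiv ℝ (fun x => fderiv ℝ (fun y => φ (y, p.2)) x (Pi.single j 1)) p.1 (Pi.single i 1)

/-- `φ` touches `u` from above at `p` within `Ω`. -/
def TouchAbove {n : ℕ} (u φ : Pt n → ℝ) (Ω : Set (Pt n)) (p : Pt n) : Prop :=
  u p = φ p ∧ ∀ᶠ q in 𝓝[Ω] p, u q ≤ φ q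

/-- `φ` touches `u` from below at `p` within `Ω`. -/
def TouchBelow {n : ℕ} (u φ : Pt n → ℝ) (Ω : Set (Pt n)) (p : Pt n) : Prop :=
  u p = φ p ∧ ∀ᶠ q in 𝓝[Ω] p, φ q ≤ u q

/-- Viscosity subsolution of `u_t - x_n^γ F(D²u, x, t) = f` in `Ω`. -/
def ViscSub {n : ℕ} [NeZero n] (γ : ℝ) (F : Matrix (Fin n) (Fin n) ℝ → Pt n → ℝ)
    (f u : Pt n → ℝ) (Ω : Set (Pt n)) : Prop :=
  ∀ p ∈ Ω, ∀ φ : Pt n → ℝ, IsTestFn φ → TouchAbove u φ Ω p →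
    timeD φ p - xlast p.1 ^ γ * F (hess φ p) p ≤ f p

/-- Viscosity supersolution of `u_t - x_n^γ F(D²u, x, t) = f` in `Ω`. -/
def ViscSuper {n : ℕ} [NeZero n] (γ : ℝ) (F : Matrix (Fin n) (Fin n) ℝ → Pt n → ℝ)
    (f u : Pt n → ℝ) (Ω : Set (Pt n)) : Prop :=
  ∀ p ∈ Ω, ∀ φ : Pt n → ℝ, IsTestFn φ → TouchBelow u φ Ω p →
    f p ≤ timeD φ p - xlast p.1 ^ γ * F (hess φ p) p

/-- The sup norm of `u` over `S`. -/
def supAbs {n : ℕ} (u : Pt n → ℝ) (S : Set (Pt n)) : ℝ := ⨆ p : S, |u ↑p|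

/-- The solution class `S*(λ,Λ,f)` in `Ω`. -/
def InSstar {n : ℕ} [NeZero n] (γ lam Lam : ℝ) (f u : Pt n → ℝ) (Ω : Set (Pt n)) : Prop :=
  ViscSub γ (fun M _ => pucciPlus lam Lam M) (fun _ => supAbs f Ω) u Ω ∧
  ViscSuper γ (fun M _ => pucciMinus lam Lam M) (fun _ => -supAbs f Ω) u Ω

/-- The solution class `S(λ,Λ,0)` in `Ω`. -/
def InS0 {n : ℕ} [NeZero n] (γ lam Lam : ℝ) (u : Pt n → ℝ) (Ω : Set (Pt n)) : Prop :=
  ViscSub γ (fun M _ => pucciPlus lam Lam M) (fun _ => 0) u Ω ∧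
  ViscSuper γ (fun M _ => pucciMinus lam Lam M) (fun _ => 0) u Ω

/-- The boundary `C^{1,ᾱ}` estimate for the homogeneous model problem, with constants
`abar` and `C₁`. -/
def ModelEstimate (n : ℕ) [NeZero n] (γ lam Lam abar C₁ : ℝ) : Prop :=
  ∀ u : Pt n → ℝ, ContinuousOn u (closure (Q1p n γ)) →
    InS0 γ lam Lam u (Q1p n γ) →
    (∀ p ∈ flatQ1p n γ, u p = 0) →
    supAbs u (Q1p n γ) ≤ 1 →
    ∃ a : ℝ, |a| ≤ C₁ ∧ ∀ p ∈ closure (Qp γ (1/2) (0 : Fin n → ℝ) 0),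
      |u p - a * xlast p.1| ≤
        C₁ * (eucNorm p.1 + |p.2| ^ ((1 : ℝ) / (2 - γ))) ^ abar * xlast p.1

/-- Structure condition (F1): uniform parabolicity. -/
def UnifParab (n : ℕ) (lam Lam : ℝ) (F : Matrix (Fin n) (Fin n) ℝ → Pt n → ℝ) : Prop :=
  ∀ M N : Matrix (Fin n) (Fin n) ℝ, M.IsSymm → N.IsSymm → ∀ p : Pt n,
    pucciMinus lam Lam (M - N) ≤ F M p - F N p ∧ F M p - F N p ≤ pucciPlus lam Lam (M - N)

/-- Structure condition (F2): `F` is concave or convex in the matrix variable. -/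
def ConcaveOrConvex (n : ℕ) (F : Matrix (Fin n) (Fin n) ℝ → Pt n → ℝ) : Prop :=
  (∀ p : Pt n, ConvexOn ℝ Set.univ fun M => F M p) ∨
  (∀ p : Pt n, ConcaveOn ℝ Set.univ fun M => F M p)

/-- The Hessian matrix of the quadratic polynomial `P(x) = ∑ i, a i * x i * x n`. -/
def quadMat (n : ℕ) [NeZero n] (a : Fin n → ℝ) : Matrix (Fin n) (Fin n) ℝ :=
  fun i j => (if j = lastIdx n then a i else 0) + (if i = lastIdx n then a j else 0)

/-- The parabolic boundary of a general set `S ⊆ ℝ^{n+1}`. -/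
def pBdry {n : ℕ} (γ : ℝ) (S : Set (Pt n)) : Set (Pt n) :=
  {p ∈ frontier S | ∀ r : ℝ, 0 < r → (Qcyl γ r p.1 p.2 ∩ Sᶜ).Nonempty}

end DPP

open DPP

theorem helper_fderiv_rpow {n : ℕ} [NeZero n] (a : ℝ) (x v : Fin n → ℝ) (hx : 0 < xlast x) :
    HasFDerivAt (fun y : Fin n → ℝ => xlast y ^ a)
      ((a * xlast x ^ (a - 1)) • (ContinuousLinearMap.proj (R := ℝ) (φ := fun _ : Fin n => ℝ)
        (lastIdx n))) x := by
  have h1 : HasFDerivAt (fun y : Fin n → ℝ => xlast y)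
      (ContinuousLinearMap.proj (R := ℝ) (φ := fun _ : Fin n => ℝ) (lastIdx n)) x :=
    (ContinuousLinearMap.proj (R := ℝ) (φ := fun _ : Fin n => ℝ) (lastIdx n)).hasFDerivAt
  exact (Real.hasDerivAt_rpow_const (Or.inl hx.ne')).comp_hasFDerivAt x h1

theorem helper_fderiv_u {n : ℕ} [NeZero n] (ε : ℝ) (h2 : 2 - ε ≠ 0)
    (x v : Fin n → ℝ) (hx : 0 < xlast x) :
    fderiv ℝ (fun y : Fin n → ℝ => 1 - xlast y ^ (2 - ε) / ((2 - ε) * (1 - ε))) x v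
      = (-1 / (1 - ε)) * xlast x ^ (1 - ε) * v (lastIdx n) := by
  have h := ((helper_fderiv_rpow (2 - ε) x v hx).mul_const ((2 - ε) * (1 - ε))⁻¹).const_sub 1
  simp only [div_eq_mul_inv]
  rw [h.fderiv]
  have e : (2 - ε - 1) = 1 - ε := by ring
  simp [e]
  field_simp

/-- **Optimality example for the degenerate equation** (Remark 1.2):
`u(x,t) = 1 - x_n^{2-ε}/((2-ε)(1-ε))` is a classical (hence viscosity) solution of
`u_t - x_n^γ Δu = x_n^{γ-ε}` in `{x_n > 0} × ℝ` with `|Du| = x_n^{1-ε}/(1-ε)`. -/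
theorem optimality_example_degenerate
    (n : ℕ) [NeZero n] (γ ε : ℝ) (hγ0 : 0 < γ) (hγ1 : γ < 1)
    (hε0 : 0 < ε) (hεγ : ε ≤ γ)
    (u : Pt n → ℝ)
    (hu : u = fun p => 1 - xlast p.1 ^ (2 - ε) / ((2 - ε) * (1 - ε))) :
    ∀ p : Pt n, 0 < xlast p.1 →
      ContDiffAt ℝ 2 (fun x => u (x, p.2)) p.1 ∧
      HasDerivAt (fun s => u (p.1, s)) 0 p.2 ∧
      timeD u p - xlast p.1 ^ γ * (hess u p).trace = xlast p.1 ^ (γ - ε) ∧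
      eucNorm (spaceGrad u p) = xlast p.1 ^ (1 - ε) / (1 - ε) := by
  intro p hp
  have h2 : 2 - ε ≠ 0 := by linarith
  have h1' : 0 < 1 - ε := by linarith
  have h1 : 1 - ε ≠ 0 := h1'.ne'
  have hcont : Continuous (fun x : Fin n → ℝ => xlast x) := continuous_apply _
  have hpos : ∀ᶠ x in 𝓝 p.1, 0 < xlast x := hcont.continuousAt.eventually (lt_mem_nhds hp)
  have hxl : ContDiff ℝ 2 (fun x : Fin n → ℝ => xlast x) := contDiff_apply ℝ ℝ (lastIdx n)
  subst hu
  refine ⟨?_, ?_, ?_, ?_⟩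
  · have hr : ContDiffAt ℝ 2 (fun x : Fin n → ℝ => xlast x ^ (2 - ε)) p.1 :=
      ContDiffAt.rpow_const_of_ne hxl.contDiffAt hp.ne'
    have hc : ContDiffAt ℝ 2 (fun _ : Fin n → ℝ => (1 : ℝ)) p.1 := contDiffAt_const
    exact hc.sub (hr.div_const _)
  · exact hasDerivAt_const (𝕜 := ℝ) (F := ℝ) p.2 (1 - xlast p.1 ^ (2 - ε) / ((2 - ε) * (1 - ε)))
  · have hH : ∀ i j, hess (fun p : Pt n => 1 - xlast p.1 ^ (2 - ε) / ((2 - ε) * (1 - ε))) p i j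
        = - xlast p.1 ^ (-ε) * (Pi.single j 1 : Fin n → ℝ) (lastIdx n)
          * (Pi.single i 1 : Fin n → ℝ) (lastIdx n) := by
      intro i j
      have he : (fun x => fderiv ℝ (fun y : Fin n → ℝ =>
            1 - xlast y ^ (2 - ε) / ((2 - ε) * (1 - ε))) x (Pi.single j 1)) =ᶠ[𝓝 p.1]
          fun x => xlast x ^ (1 - ε) *
            ((-1 / (1 - ε)) * (Pi.single j 1 : Fin n → ℝ) (lastIdx n)) := by
        filter_upwards [hpos] with x hx
        rw [helper_fderiv_u ε h2 x _ hx]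
        ring
      have hd := (helper_fderiv_rpow (1 - ε) p.1 0 hp).mul_const
        ((-1 / (1 - ε)) * (Pi.single j 1 : Fin n → ℝ) (lastIdx n))
      show fderiv ℝ (fun x => fderiv ℝ (fun y : Fin n → ℝ =>
            1 - xlast y ^ (2 - ε) / ((2 - ε) * (1 - ε))) x (Pi.single j 1)) p.1 (Pi.single i 1) = _
      rw [he.fderiv_eq, hd.fderiv]
      have e : (1 - ε - 1) = - ε := by ring
      simp only [_root_.smul_apply, ContinuousLinearMap.proj_apply, smul_eq_mul, e]
      field_simp
    have ht : (hess (fun p : Pt n => 1 - xlast p.1 ^ (2 - ε) / ((2 - ε) * (1 - ε))) p).trace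
        = - xlast p.1 ^ (-ε) := by
      simp only [Matrix.trace, Matrix.diag_apply, hH]
      rw [Finset.sum_eq_single (lastIdx n)]
      · simp
      · intro b _ hb
        simp [Pi.single_eq_of_ne hb.symm]
      · simp
    rw [ht]
    simp only [timeD, deriv_const]
    rw [sub_eq_add_neg γ ε, Real.rpow_add hp]
    ring
  · have hg : ∀ i, spaceGrad (fun p : Pt n => 1 - xlast p.1 ^ (2 - ε) / ((2 - ε) * (1 - ε))) p i
        = (-1 / (1 - ε)) * xlast p.1 ^ (1 - ε) * (Pi.single i 1 : Fin n → ℝ) (lastIdx n) :=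
      fun i => helper_fderiv_u ε h2 p.1 _ hp
    simp only [eucNorm, hg]
    rw [Finset.sum_eq_single (lastIdx n)]
    · rw [Real.sqrt_sq_eq_abs, Pi.single_eq_same, mul_one, neg_div, neg_mul, abs_neg, abs_of_nonneg]
      · ring
      · positivity
    · intro b _ hb
      simp [Pi.single_eq_of_ne hb.symm]
    · simp
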